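/- Let N ≥ 2, let {(u_i,w_i)}_{i=1}^m ⊆ S^{N-1} × [0,∞) be an ε-accurate quadrature, let 𝒮 = {u_i}_{i=1}^m have dispersion δ = disp(𝒮), and assume ε, δ ≤ 1/(10√N). Then every 𝓑 ∈ 𝒟^γ (for γ ≥ 0) satisfies sup_{p ∈ 𝓑} ‖p‖ ≤ 12√N(‖C‖_∞ + γ). -/

import Mathlib

open MeasureTheory Metric Set TopologicalSpace Filter
open scoped RealInnerProductSpace NNReal ENNReal

noncomputable section

abbrev Euc (N : ℕ) := EuclideanSpace ℝ (Fin N)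

/-- The outreach (support) function of a set. -/
def outreach {N : ℕ} (B : Set (Euc N)) (u : Euc N) : ℝ :=
  sSup ((fun b => ⟪b, u⟫) '' B)

/-- The half-space `Π⁻(u,b)`. -/
def halfSpace {N : ℕ} (u : Euc N) (b : ℝ) : Set (Euc N) := {x | ⟪u, x⟫ ≤ b}

/-- The uniform probability measure on the unit sphere. -/
def sphereMeasure (N : ℕ) : Measure (Metric.sphere (0 : Euc N) 1) :=
  (((volume : Measure (Euc N)).toSphere) Set.univ)⁻¹ • ((volume : Measure (Euc N)).toSphere)

/-- The sup-norm of a function restricted to the unit sphere. -/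
def supNormSphere {N : ℕ} (f : Euc N → ℝ) : ℝ :=
  ⨆ x : Metric.sphere (0 : Euc N) 1, |f x|

/-- The dispersion of a set of directions. -/
def dispersion {N : ℕ} (S : Set (Euc N)) : ℝ :=
  ⨆ u : Metric.sphere (0 : Euc N) 1, ⨅ v : S, ‖(u : Euc N) - (v : Euc N)‖

/-- `ε`-accurate quadrature on the unit sphere. -/
def IsAccurateQuadrature {N : ℕ} {ι : Type*} [Fintype ι]
    (u : ι → Euc N) (w : ι → ℝ) (ε : ℝ) : Prop :=
  (∀ i, u i ∈ Metric.sphere (0 : Euc N) 1) ∧ (∀ i, 0 ≤ w i) ∧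
  ∀ (L : ℝ≥0) (f : Euc N → ℝ), LipschitzOnWith L f (Metric.sphere (0 : Euc N) 1) →
    |(∫ x : Metric.sphere (0 : Euc N) 1, f x ∂(sphereMeasure N)) - ∑ i, w i * f (u i)|
      ≤ ε * (L + supNormSphere f)

/-- Halved mean width. -/
def meanHalfWidth {N : ℕ} (B : Set (Euc N)) : ℝ :=
  ∫ u : Metric.sphere (0 : Euc N) 1, outreach B (u : Euc N) ∂(sphereMeasure N)

/-- Feasible solutions of the continuous problem. -/
def CInf {N : ℕ} (C : Euc N → ℝ) : Set (Set (Euc N)) :=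
  {B | B.Nonempty ∧ Convex ℝ B ∧ IsCompact B ∧
    ∀ u ∈ Metric.sphere (0 : Euc N) 1, C u ≤ outreach B u}

/-- Optimal value of the continuous problem. -/
def VCP {N : ℕ} (C : Euc N → ℝ) : ℝ := sInf (meanHalfWidth '' CInf C)

/-- `γ`-near optimal solutions of the continuous problem. -/
def CGamma {N : ℕ} (C : Euc N → ℝ) (γ : ℝ) : Set (Set (Euc N)) :=
  {B ∈ CInf C | meanHalfWidth B - VCP C ≤ γ}

/-- Feasible solutions of the discrete problem with node set `S`. -/
def DInf {N : ℕ} (C : Euc N → ℝ) (S : Set (Euc N)) : Set (Set (Euc N)) :=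
  {B | B.Nonempty ∧ Convex ℝ B ∧ IsCompact B ∧ ∀ u ∈ S, C u ≤ outreach B u}

/-- Discrete objective. -/
def quadSum {N : ℕ} {ι : Type*} [Fintype ι] (u : ι → Euc N) (w : ι → ℝ)
    (B : Set (Euc N)) : ℝ :=
  ∑ i, w i * outreach B (u i)

/-- Optimal value of the discrete problem. -/
def VDP {N : ℕ} {ι : Type*} [Fintype ι] (u : ι → Euc N) (w : ι → ℝ) (C : Euc N → ℝ) : ℝ :=
  sInf (quadSum u w '' DInf C (Set.range u))

/-- `γ`-near optimal solutions of the discrete problem. -/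
def DGamma {N : ℕ} {ι : Type*} [Fintype ι] (u : ι → Euc N) (w : ι → ℝ) (C : Euc N → ℝ)
    (γ : ℝ) : Set (Set (Euc N)) :=
  {B ∈ DInf C (Set.range u) | quadSum u w B - VDP u w C ≤ γ}

open ProbabilityTheory in
lemma aux_abs_gauss : (7/10 : ℝ) ≤ ∫ t, |t| ∂(gaussianReal 0 1) := by
  rw [integral_gaussianReal_eq_integral_smul one_ne_zero]
  have h1 : ∀ t : ℝ, gaussianPDFReal 0 1 t • |t|
      = (fun s : ℝ => (√(2 * Real.pi))⁻¹ * (s ^ (1:ℝ) * Real.exp (-(1/2) * s ^ (2:ℝ)))) |t| := by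
    intro t
    simp only [gaussianPDFReal, smul_eq_mul, NNReal.coe_one, mul_one, sub_zero, Real.rpow_one,
      Real.rpow_two, sq_abs]
    rw [show -t ^ 2 / 2 = -(1/2) * t ^ 2 by ring]
    ring
  simp_rw [h1]
  rw [integral_comp_abs (f := fun s : ℝ => (√(2 * Real.pi))⁻¹ * (s ^ (1:ℝ) * Real.exp (-(1/2) * s ^ (2:ℝ)))),
    integral_const_mul, integral_rpow_mul_exp_neg_mul_rpow (by norm_num) (by norm_num) (by norm_num)]
  norm_num
  have hs : √(2 * Real.pi) ≤ 20 / 7 := by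
    rw [Real.sqrt_le_left (by norm_num)]
    nlinarith [Real.pi_lt_d2]
  have hp : 0 < √(2 * Real.pi) := by positivity
  have : (20/7 : ℝ)⁻¹ ≤ (√(2 * Real.pi))⁻¹ := by gcongr
  have e : (√Real.pi)⁻¹ * (√2)⁻¹ = (√(2 * Real.pi))⁻¹ := by
    rw [Real.sqrt_mul (by norm_num), mul_inv, mul_comm]
  linarith

open ProbabilityTheory in
lemma aux_density (N : ℕ) : ∃ Z : ℝ, 0 < Z ∧ stdGaussian (Euc N) =
    (volume : Measure (Euc N)).withDensity
      (fun x => ENNReal.ofReal (Z * Real.exp (-(1/2) * ‖x‖ ^ 2))) := by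
  refine ⟨((Real.pi / (1/2)) ^ (Module.finrank ℝ (Euc N) / 2 : ℝ))⁻¹, by positivity, ?_⟩
  set Z : ℝ := ((Real.pi / (1/2)) ^ (Module.finrank ℝ (Euc N) / 2 : ℝ)) with hZ
  have hZ0 : 0 < Z := by positivity
  have hint : Integrable (fun x : Euc N => Z⁻¹ * Real.exp (-(1/2) * ‖x‖ ^ 2)) := by
    apply Integrable.const_mul
    have := GaussianFourier.integrable_cexp_neg_mul_sq_norm_add (V := Euc N) (b := 1/2)
      (by norm_num) 0 0
    have h2 := this.re
    refine h2.congr (ae_of_all _ fun x => ?_)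
    have : (-(1/2 : ℂ) * (‖x‖:ℂ) ^ 2 + 0 * ((⟪(0 : Euc N), x⟫ : ℝ) : ℂ))
      = ((-(1/2) * ‖x‖ ^ 2 : ℝ) : ℂ) := by push_cast; ring
    simp only [this]
    exact Complex.exp_ofReal_re _
  have := isFiniteMeasure_withDensity_ofReal hint.2
  refine Measure.ext_of_charFun ?_
  ext t
  rw [charFun_stdGaussian, charFun_apply]
  have hm : Measurable (fun x : Euc N => Real.toNNReal (Z⁻¹ * Real.exp (-(1/2) * ‖x‖ ^ 2))) := by
    fun_prop
  have := integral_withDensity_eq_integral_smul (μ := (volume : Measure (Euc N))) hm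
    (fun x => Complex.exp (((⟪x, t⟫ : ℝ) : ℂ) * Complex.I))
  refine Eq.trans ?_ this.symm
  have e : ∀ x : Euc N, Real.toNNReal (Z⁻¹ * Real.exp (-(1/2) * ‖x‖ ^ 2)) •
      Complex.exp (((⟪x, t⟫ : ℝ) : ℂ) * Complex.I)
      = (Z : ℂ)⁻¹ * Complex.exp (-(1/2 : ℂ) * (‖x‖:ℂ) ^ 2 + Complex.I * ((⟪t, x⟫ : ℝ) : ℂ)) := by
    intro x
    rw [NNReal.smul_def, Real.coe_toNNReal _ (by positivity), Complex.exp_add, Complex.real_smul,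
      real_inner_comm]
    push_cast
    rw [mul_comm Complex.I, mul_assoc]
  simp_rw [e]
  rw [integral_const_mul, GaussianFourier.integral_cexp_neg_mul_sq_norm_add (by norm_num)]
  have e2 : (Real.pi / (1/2 : ℂ)) ^ (Module.finrank ℝ (Euc N) / 2 : ℂ) = (Z : ℂ) := by
    rw [hZ, Complex.ofReal_cpow (by positivity)]
    push_cast; rfl
  rw [e2, ← mul_assoc, inv_mul_cancel₀ (by exact_mod_cast hZ0.ne'), one_mul, Complex.I_sq]
  congr 1
  ring

lemma aux_polar {N : ℕ} (hN : 0 < N) : ∃ J : ℝ, ∀ F : Euc N → ℝ,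
    (∀ (r : ℝ) (x : Euc N), 0 < r → F (r • x) = r * F x) →
    ∫ x, F x * Real.exp (-(1/2) * ‖x‖ ^ 2) =
      (∫ x : Metric.sphere (0 : Euc N) 1, F x ∂((volume : Measure (Euc N)).toSphere)) * J := by
  have : Nonempty (Fin N) := ⟨⟨0, hN⟩⟩
  refine ⟨∫ r : Ioi (0:ℝ), (r:ℝ) * Real.exp (-(1/2) * (r:ℝ) ^ 2)
    ∂(Measure.volumeIoiPow (Module.finrank ℝ (Euc N) - 1)), fun F hF => ?_⟩
  rw [← integral_prod_mul (fun x : Metric.sphere (0 : Euc N) 1 => F x)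
    (fun r : Ioi (0:ℝ) => (r:ℝ) * Real.exp (-(1/2) * (r:ℝ) ^ 2)),
    ← ((volume : Measure (Euc N)).measurePreserving_homeomorphUnitSphereProd).integral_comp
        (Homeomorph.measurableEmbedding _),
    ← restrict_compl_singleton (μ := (volume : Measure (Euc N))) 0,
    ← integral_subtype_comap (measurableSet_singleton _).compl
      (fun x : Euc N => F x * Real.exp (-(1/2) * ‖x‖ ^ 2)), restrict_compl_singleton]
  congr 1
  ext x
  have hx : 0 < ‖(x : Euc N)‖ := norm_pos_iff.2 x.2
  simp only [homeomorphUnitSphereProd_apply_snd_coe, homeomorphUnitSphereProd_apply_fst_coe]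
  rw [hF _ _ (by positivity)]
  field_simp

open ProbabilityTheory in
lemma aux_sphere {N : ℕ} (hN : 0 < N) (F : Euc N → ℝ)
    (hF : ∀ (r : ℝ) (x : Euc N), 0 < r → F (r • x) = r * F x) :
    ∫ x, F x ∂(stdGaussian (Euc N)) =
      (∫ x : Metric.sphere (0 : Euc N) 1, F x ∂(sphereMeasure N)) *
        ∫ x, ‖x‖ ∂(stdGaussian (Euc N)) := by
  have : Nonempty (Fin N) := ⟨⟨0, hN⟩⟩
  obtain ⟨Z, hZ, hd⟩ := aux_density N
  obtain ⟨J, hJ⟩ := aux_polar hN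
  have hm : Measurable (fun x : Euc N => Real.toNNReal (Z * Real.exp (-(1/2) * ‖x‖ ^ 2))) := by
    fun_prop
  have key : ∀ G : Euc N → ℝ, (∀ (r : ℝ) (x : Euc N), 0 < r → G (r • x) = r * G x) →
      ∫ x, G x ∂(stdGaussian (Euc N)) = Z * 
      ((∫ x : Metric.sphere (0 : Euc N) 1, G x ∂((volume : Measure (Euc N)).toSphere)) * J) := by
    intro G hG
    rw [hd, ← hJ G hG, ← integral_const_mul]
    refine (integral_withDensity_eq_integral_smul (μ := (volume : Measure (Euc N))) hm G).trans ?_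
    congr 1
    ext x
    rw [NNReal.smul_def, Real.coe_toNNReal _ (by positivity), smul_eq_mul]
    ring
  rw [key F hF, key (fun x => ‖x‖) (fun r x hr => by simp [norm_smul, abs_of_pos hr]),
    sphereMeasure, integral_smul_measure]
  have h1 : ∫ x : Metric.sphere (0 : Euc N) 1, ‖(x : Euc N)‖ ∂((volume : Measure (Euc N)).toSphere)
      = ((volume : Measure (Euc N)).toSphere univ).toReal := by
    simp [measureReal_def]
  rw [h1, ENNReal.toReal_inv, smul_eq_mul]
  have : ((volume : Measure (Euc N)).toSphere univ).toReal ≠ 0 := by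
    rw [ENNReal.toReal_ne_zero]
    refine ⟨?_, measure_ne_top _ _⟩
    rw [Measure.measure_univ_ne_zero]
    exact Measure.toSphere_ne_zero _
  field_simp

open ProbabilityTheory in
lemma aux_norm_le (N : ℕ) (hN : 0 < N) : ∫ x, ‖x‖ ∂(stdGaussian (Euc N)) ≤ √N := by
  have hL2 : MemLp id 2 (stdGaussian (Euc N)) := IsGaussian.memLp_two_id
  have hi : Integrable (fun x : Euc N => ‖x‖) (stdGaussian (Euc N)) :=
    (IsGaussian.integrable_id (μ := stdGaussian (Euc N))).norm
  have hi2 : Integrable (fun x : Euc N => ‖x‖ ^ 2) (stdGaussian (Euc N)) := hL2.integrable_norm_pow (by norm_num)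
  have hc : ∀ i : Fin N, ∫ x, (x i) ^ 2 ∂(stdGaussian (Euc N)) = 1 := by
    intro i
    have h := variance_dual_stdGaussian (E := Euc N) (innerSL ℝ (EuclideanSpace.single i (1:ℝ)))
    rw [variance_of_integral_eq_zero (by fun_prop) (integral_strongDual_stdGaussian _)] at h
    simpa [innerSL_apply_apply, EuclideanSpace.inner_single_left] using h
  have hs : ∫ x, ‖x‖ ^ 2 ∂(stdGaussian (Euc N)) = N := by
    simp_rw [EuclideanSpace.norm_sq_eq, Real.norm_eq_abs, sq_abs]
    rw [integral_finsetSum]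
    · simp [hc]
    · intro i _
      refine hi2.mono' (by fun_prop) (ae_of_all _ fun x => ?_)
      rw [EuclideanSpace.norm_sq_eq, Real.norm_eq_abs, abs_of_nonneg (sq_nonneg _)]
      have := Finset.single_le_sum (f := fun j => ‖x j‖ ^ 2) (fun j _ => sq_nonneg _)
        (Finset.mem_univ i)
      simpa using this
  have hsN : 0 < √(N:ℝ) := Real.sqrt_pos.2 (by exact_mod_cast hN)
  have hle : ∫ x, ‖x‖ ∂(stdGaussian (Euc N)) ≤
      ∫ x, ((2 * √N)⁻¹ * ‖x‖ ^ 2 + √N / 2) ∂(stdGaussian (Euc N)) := by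
    refine integral_mono hi ((hi2.const_mul _).add (integrable_const _)) fun x => ?_
    have : 0 ≤ (2 * √(N:ℝ))⁻¹ * (‖x‖ - √N) ^ 2 := by positivity
    have e : (2 * √(N:ℝ))⁻¹ * (‖x‖ - √N) ^ 2 = (2 * √N)⁻¹ * ‖x‖ ^ 2 + √N / 2 - ‖x‖ := by
      field_simp; ring
    simp only
    linarith
  rw [integral_add (hi2.const_mul _) (integrable_const _), integral_const_mul, hs] at hle
  have e : (2 * √(N:ℝ))⁻¹ * N = √N / 2 := by
    field_simp
    rw [Real.sq_sqrt (by positivity)]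
  rw [e] at hle
  simp at hle
  linarith

open ProbabilityTheory in
lemma aux_inner {N : ℕ} (p : Euc N) (hp : p ≠ 0) :
    (7/10) * ‖p‖ ≤ ∫ x, |⟪p, x⟫| ∂(stdGaussian (Euc N)) := by
  have hp' : 0 < ‖p‖ := norm_pos_iff.2 hp
  set e : Euc N := ‖p‖⁻¹ • p with he
  have hen : ‖e‖ = 1 := by
    rw [he, norm_smul, norm_inv, norm_norm, inv_mul_cancel₀ hp'.ne']
  have hmap := IsGaussian.map_eq_gaussianReal (μ := stdGaussian (Euc N)) (innerSL ℝ e)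
  rw [integral_strongDual_stdGaussian, variance_dual_stdGaussian, innerSL_apply_norm, hen] at hmap
  norm_num at hmap
  have h := aux_abs_gauss
  rw [← hmap, integral_map (by fun_prop) (by fun_prop)] at h
  have e2 : ∀ x : Euc N, |⟪p, x⟫| = ‖p‖ * |⟪e, x⟫| := by
    intro x
    rw [he, real_inner_smul_left, abs_mul, abs_inv, abs_norm]
    field_simp
  simp_rw [e2]
  rw [integral_const_mul]
  nlinarith

open ProbabilityTheory in
lemma aux_lower {N : ℕ} (hN : 0 < N) (p : Euc N) (hp : p ≠ 0) (K : ℝ) :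
    (7/20) * ‖p‖ ≤ √N * ((∫ x : Metric.sphere (0 : Euc N) 1, max ⟪p, (x : Euc N)⟫ (-K)
      ∂(sphereMeasure N)) + K / 2) := by
  have hp' : 0 < ‖p‖ := norm_pos_iff.2 hp
  set F : Euc N → ℝ := fun x => max ⟪p, x⟫ (-K * ‖x‖) with hF
  have hhom : ∀ (r : ℝ) (x : Euc N), 0 < r → F (r • x) = r * F x := by
    intro r x hr
    simp only [hF, real_inner_smul_right, norm_smul, Real.norm_eq_abs, abs_of_pos hr]
    rw [mul_max_of_nonneg _ _ hr.le]
    congr 1; ring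
  have hS := aux_sphere hN F hhom
  have hSF : (∫ x : Metric.sphere (0 : Euc N) 1, max ⟪p, (x : Euc N)⟫ (-K) ∂(sphereMeasure N))
      = ∫ x : Metric.sphere (0 : Euc N) 1, F x ∂(sphereMeasure N) := by
    simp [hF]
  rw [hSF]
  have hn : Integrable (fun x : Euc N => ‖x‖) (stdGaussian (Euc N)) :=
    (IsGaussian.integrable_id (μ := stdGaussian (Euc N))).norm
  have hin : Integrable (fun x : Euc N => ⟪p, x⟫) (stdGaussian (Euc N)) :=
    (IsGaussian.integrable_id (μ := stdGaussian (Euc N))).const_inner p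
  have hFi : Integrable F (stdGaussian (Euc N)) := hin.sup (hn.const_mul _)
  have hneg : ∫ x, F (-x) ∂(stdGaussian (Euc N)) = ∫ x, F x ∂(stdGaussian (Euc N)) := by
    have h := stdGaussian_map (LinearIsometryEquiv.neg ℝ : Euc N ≃ₗᵢ[ℝ] Euc N)
    conv_rhs => rw [← h]
    rw [integral_map (by fun_prop) (by fun_prop)]
    simp
  have hFi' : Integrable (fun x => F (-x)) (stdGaussian (Euc N)) := by
    have : (fun x => F (-x)) = fun x => max (-⟪p, x⟫) (-K * ‖x‖) := by
      ext x; simp [hF]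
    rw [this]
    exact hin.neg.sup (hn.const_mul _)
  have hle : ∫ x, (|⟪p, x⟫| - K * ‖x‖) ∂(stdGaussian (Euc N)) ≤
      ∫ x, (F x + F (-x)) ∂(stdGaussian (Euc N)) := by
    refine integral_mono (hin.abs.sub (hn.const_mul _)) (hFi.add hFi') fun x => ?_
    simp only [hF, norm_neg, inner_neg_right]
    rcases abs_cases ⟪p, x⟫ with ⟨h, _⟩ | ⟨h, _⟩ <;> rw [h]
    · linarith [le_max_left ⟪p, x⟫ (-K * ‖x‖), le_max_right (-⟪p, x⟫) (-K * ‖x‖)]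
    · linarith [le_max_right ⟪p, x⟫ (-K * ‖x‖), le_max_left (-⟪p, x⟫) (-K * ‖x‖)]
  rw [integral_sub hin.abs (hn.const_mul _), integral_add hFi hFi', hneg, integral_const_mul, hS]
    at hle
  have h1 := aux_inner p hp
  have h2 := aux_norm_le N hN
  have h3 : 0 ≤ ∫ x, ‖x‖ ∂(stdGaussian (Euc N)) := integral_nonneg fun _ => norm_nonneg _
  set M := ∫ x, ‖x‖ ∂(stdGaussian (Euc N))
  set I := ∫ x : Metric.sphere (0 : Euc N) 1, F x ∂(sphereMeasure N)
  have h4 : (7/20) * ‖p‖ ≤ M * (I + K / 2) := by nlinarith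
  have h5 : 0 ≤ I + K / 2 := by
    by_contra hcon
    push Not at hcon
    nlinarith
  nlinarith

lemma aux_prob {N : ℕ} (hN : 0 < N) : IsProbabilityMeasure (sphereMeasure N) := by
  have : Nonempty (Fin N) := ⟨⟨0, hN⟩⟩
  constructor
  rw [sphereMeasure, Measure.smul_apply, smul_eq_mul]
  refine ENNReal.inv_mul_cancel ?_ (measure_ne_top _ _)
  rw [Measure.measure_univ_ne_zero]
  exact Measure.toSphere_ne_zero _

lemma le_outreach {N : ℕ} {B : Set (Euc N)} (hB : IsCompact B) {b : Euc N} (hb : b ∈ B)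
    (x : Euc N) : ⟪b, x⟫ ≤ outreach B x := by
  refine le_csSup ?_ ⟨b, hb, rfl⟩
  exact (hB.image (by fun_prop)).bddAbove

theorem norm_bound_of_mem_DGamma {N m : ℕ} (hN : 2 ≤ N)
    (u : Fin m → Euc N) (w : Fin m → ℝ) (ε : ℝ)
    (hq : IsAccurateQuadrature u w ε)
    (δ : ℝ) (hδ : δ = dispersion (Set.range u))
    (hε : ε ≤ 1 / (10 * Real.sqrt N)) (hδ' : δ ≤ 1 / (10 * Real.sqrt N))
    (C : Euc N → ℝ) (LC : ℝ≥0) (hC : LipschitzOnWith LC C (Metric.sphere (0 : Euc N) 1))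
    (γ : ℝ) (hγ : 0 ≤ γ) (B : Set (Euc N)) (hB : B ∈ DGamma u w C γ) :
    sSup ((fun p : Euc N => ‖p‖) '' B) ≤ 12 * Real.sqrt N * (supNormSphere C + γ) := by
  have hN0 : 0 < N := by omega
  have : Nonempty (Fin N) := ⟨⟨0, hN0⟩⟩
  have hprob := aux_prob hN0
  have hSne : Nonempty (Metric.sphere (0 : Euc N) 1) :=
    (NormedSpace.sphere_nonempty.2 zero_le_one).to_subtype
  obtain ⟨hu, hw, hquad⟩ := hq
  obtain ⟨⟨hBne, hBconv, hBc, hBC⟩, hBγ⟩ := hB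
  set K := supNormSphere C with hK
  -- bound on C
  have hbdd : BddAbove (range fun x : Metric.sphere (0 : Euc N) 1 => |C x|) := by
    have hcont : Continuous (fun x : Metric.sphere (0 : Euc N) 1 => |C x|) :=
      (continuousOn_iff_continuous_domRestrict.1 hC.continuousOn).abs
    exact (isCompact_range hcont).bddAbove
  have hCK : ∀ x ∈ Metric.sphere (0 : Euc N) 1, |C x| ≤ K := fun x hx => le_ciSup hbdd ⟨x, hx⟩
  have hK0 : 0 ≤ K := Real.iSup_nonneg fun _ => abs_nonneg _
  -- constants
  have hs : (1:ℝ) ≤ √N := by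
    rw [Real.one_le_sqrt]; exact_mod_cast (by omega : 1 ≤ N)
  have h1 := hquad 0 (fun _ => 1) ((LipschitzWith.const 1).lipschitzOnWith)
  have hsup1 : supNormSphere (fun _ : Euc N => (1:ℝ)) = 1 := by simp [supNormSphere]
  rw [hsup1] at h1
  simp only [integral_const, probReal_univ, smul_eq_mul, mul_one, NNReal.coe_zero, zero_add] at h1
  have hε0 : 0 ≤ ε := (abs_nonneg _).trans h1
  have hW : ∑ i, w i ≤ 1 + ε := by linarith [(abs_le.1 h1).1]
  have hεs : ε * √N ≤ 1 / 10 := by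
    rw [le_div_iff₀ (by positivity)] at hε; linarith
  -- value bound
  have hbelow : BddBelow (quadSum u w '' DInf C (Set.range u)) := by
    refine ⟨∑ i, w i * C (u i), ?_⟩
    rintro _ ⟨A, hA, rfl⟩
    exact Finset.sum_le_sum fun i _ => mul_le_mul_of_nonneg_left (hA.2.2.2 _ ⟨i, rfl⟩) (hw i)
  have hV : VDP u w C ≤ K * (1 + ε) := by
    have hmem : closedBall (0 : Euc N) K ∈ DInf C (Set.range u) := by
      refine ⟨⟨0, by simpa using hK0⟩, convex_closedBall _ _, isCompact_closedBall _ _, ?_⟩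
      rintro _ ⟨i, rfl⟩
      have hn : ‖u i‖ = 1 := by simpa using hu i
      refine ((le_abs_self _).trans (hCK _ (hu i))).trans ?_
      have := le_outreach (isCompact_closedBall (0 : Euc N) K) (b := K • u i)
        (by simp [norm_smul, hn, abs_of_nonneg hK0]) (u i)
      rwa [real_inner_smul_left, real_inner_self_eq_norm_sq, hn, one_pow, mul_one] at this
    refine (csInf_le hbelow ⟨_, hmem, rfl⟩).trans ?_
    calc quadSum u w (closedBall 0 K) ≤ ∑ i, w i * K := by
          refine Finset.sum_le_sum fun i _ => mul_le_mul_of_nonneg_left ?_ (hw i)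
          refine csSup_le (Set.Nonempty.image _ ⟨0, by simpa using hK0⟩) ?_
          rintro _ ⟨b, hb, rfl⟩
          have hn : ‖u i‖ = 1 := by simpa using hu i
          have hb' : ‖b‖ ≤ K := by simpa using hb
          have := real_inner_le_norm b (u i)
          rw [hn, mul_one] at this
          exact this.trans hb'
      _ = K * ∑ i, w i := by rw [← Finset.sum_mul, mul_comm]
      _ ≤ K * (1 + ε) := by gcongr
  -- main
  refine csSup_le (hBne.image _) ?_
  rintro _ ⟨p, hp, rfl⟩
  simp only
  rcases le_or_gt ‖p‖ K with hpK | hpK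
  · nlinarith [mul_nonneg (by linarith : (0:ℝ) ≤ 12 * √N - 1) hK0, mul_nonneg (by linarith : (0:ℝ) ≤ √N) hγ]
  have hp0 : p ≠ 0 := by rintro rfl; simp at hpK; linarith
  have hlow := aux_lower hN0 p hp0 K
  have hLip : LipschitzOnWith ‖p‖₊ (fun x : Euc N => max ⟪p, x⟫ (-K))
      (Metric.sphere (0 : Euc N) 1) := by
    apply LipschitzWith.lipschitzOnWith
    apply LipschitzWith.max_const
    refine LipschitzWith.of_dist_le_mul fun x y => ?_
    rw [Real.dist_eq, ← inner_sub_right, dist_eq_norm]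
    exact abs_real_inner_le_norm _ _
  have h2 := hquad _ _ hLip
  have hsup : supNormSphere (fun x : Euc N => max ⟪p, x⟫ (-K)) ≤ ‖p‖ := by
    refine ciSup_le fun x => ?_
    have hn : ‖(x : Euc N)‖ = 1 := by simp
    have := abs_real_inner_le_norm p (x : Euc N)
    rw [hn, mul_one] at this
    rw [abs_le] at this ⊢
    exact ⟨this.1.trans (le_max_left _ _), max_le this.2 (by linarith)⟩
  have h3 : ∑ i, w i * max ⟪p, u i⟫ (-K) ≤ quadSum u w B := by
    refine Finset.sum_le_sum fun i _ => mul_le_mul_of_nonneg_left ?_ (hw i)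
    exact max_le (le_outreach hBc hp _)
      ((abs_le.1 (hCK _ (hu i))).1.trans (hBC _ ⟨i, rfl⟩))
  have h4 := (abs_le.1 h2).2
  rw [coe_nnnorm] at h4
  have h5 : ε * (‖p‖ + supNormSphere (fun x : Euc N => max ⟪p, x⟫ (-K))) ≤ ε * (2 * ‖p‖) :=
    mul_le_mul_of_nonneg_left (by linarith) hε0
  set I := ∫ x : Metric.sphere (0 : Euc N) 1, max ⟪p, (x : Euc N)⟫ (-K) ∂(sphereMeasure N)
  have h6 : I + K / 2 ≤ K * (1 + ε) + γ + ε * (2 * ‖p‖) + K / 2 := by linarith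
  have h7 : √N * (I + K / 2) ≤ √N * (K * (1 + ε) + γ + ε * (2 * ‖p‖) + K / 2) :=
    mul_le_mul_of_nonneg_left h6 (by linarith)
  have h8 : ε * √N * ‖p‖ ≤ 1 / 10 * ‖p‖ := mul_le_mul_of_nonneg_right hεs (norm_nonneg _)
  have h9 : ε * √N * K ≤ 1 / 10 * K := mul_le_mul_of_nonneg_right hεs hK0
  have h10 : K ≤ √N * K := le_mul_of_one_le_left hK0 hs
  have h11 : 0 ≤ √N * γ := by positivity
  nlinarith
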